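/- arXiv:2301.07948 — 3 statements merged into one kernel-verified Lean document; each statement's English description precedes it below -/
import Mathlib

section
/- Let R be a periodic ring which is Armendariz: for any two polynomials f, g ∈ R[X], if f·g = 0 then (f.coeff i)·(g.coeff j) = 0 for all natural numbers i, j. Then for every positive integer n, the full matrix ring Mₙ(R) (Matrix (Fin n) (Fin n) R) is periodic. -/
/-- A ring `R` is *periodic* if for every `x ∈ R` there exist positive integers
`m > n` with `x ^ m = x ^ n`. -/
def IsPeriodicRing (R : Type*) [Ring R] : Prop :=
  ∀ x : R, ∃ m n : ℕ, 0 < n ∧ n < m ∧ x ^ m = x ^ n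

section Armendariz

variable {R : Type*} [Ring R]

/-- A ring is *Armendariz* if `f * g = 0` for polynomials `f`, `g` forces every product of a
coefficient of `f` with a coefficient of `g` to vanish. -/
def IsArmendarizRing (R : Type*) [Ring R] : Prop :=
  ∀ f g : Polynomial R, f * g = 0 → ∀ i j : ℕ, f.coeff i * g.coeff j = 0

open Polynomial in
/-- Nilpotent elements can be inserted into a vanishing product. -/
theorem IsArmendarizRing.mul_mul_eq_zero (hR : IsArmendarizRing R) {a b c : R}
    (ha : IsNilpotent a) (hbc : b * c = 0) : b * a * c = 0 := by
  have hX : IsNilpotent (C a * X : R[X]) := by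
    obtain ⟨k, hk⟩ := ha
    refine ⟨k, ?_⟩
    rw [(commute_X (C a)).symm.mul_pow, ← C_pow, hk, C_0, zero_mul]
  obtain ⟨u, hu⟩ := hX.isUnit_one_sub
  have hfg : (C b * ↑u) * (↑u⁻¹ * C c : R[X]) = 0 := by
    rw [mul_assoc, Units.mul_inv_cancel_left, ← C_mul, hbc, C_0]
  have hcoeff := hR _ _ hfg 1 0
  have hzero : (↑u⁻¹ : R[X]).coeff 0 = 1 := by
    have h := congrArg (fun f : R[X] => f.coeff 0) u.mul_inv
    simpa [hu, mul_coeff_zero] using h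
  rw [hu, coeff_C_mul, coeff_mul_C, hzero] at hcoeff
  simpa [coeff_one, coeff_X] using hcoeff

theorem IsArmendarizRing.mul_prod_eq_zero_of_sublist (hR : IsArmendarizRing R)
    {l l' : List R} (hl : l.Sublist l') (hnil : ∀ a ∈ l', IsNilpotent a) (b : R)
    (hb : b * l.prod = 0) : b * l'.prod = 0 := by
  induction hl generalizing b with
  | slnil => exact hb
  | cons a _ ih =>
    rw [List.prod_cons, ← mul_assoc]
    exact ih (fun x hx => hnil x (List.mem_cons_of_mem _ hx)) _
      (hR.mul_mul_eq_zero (hnil a List.mem_cons_self) hb)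
  | cons_cons a _ ih =>
    rw [List.prod_cons, ← mul_assoc] at hb ⊢
    exact ih (fun x hx => hnil x (List.mem_cons_of_mem _ hx)) _ hb

/-- Finitely many nilpotent elements of an Armendariz ring generate a nilpotent subring. -/
theorem IsArmendarizRing.exists_list_prod_eq_zero (hR : IsArmendarizRing R)
    (s : Finset R) (hs : ∀ a ∈ s, IsNilpotent a) :
    ∃ N : ℕ, ∀ l : List R, (∀ a ∈ l, a ∈ s) → l.length = N → l.prod = 0 := by
  classical
  refine ⟨∑ a ∈ s, nilpotencyClass a + 1, fun l hl hlen => ?_⟩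
  obtain ⟨a, ha, hcount⟩ : ∃ a ∈ s, nilpotencyClass a ≤ l.count a := by
    by_contra! h
    have hsum : ∑ a ∈ s, l.count a = l.length := by
      simpa using Multiset.sum_count_eq_card (s := s) (m := (l : Multiset R)) (by simpa using hl)
    have := Finset.sum_le_sum fun a ha => (h a ha).le
    omega
  have hsub := List.replicate_sublist_iff.2 hcount
  simpa using hR.mul_prod_eq_zero_of_sublist hsub (fun x hx => hs x (hl x hx)) 1
    (by rw [List.prod_replicate, pow_nilpotencyClass (hs a ha), mul_zero])

theorem Matrix.mul_pow_apply_eq_zero {n : Type*} [Fintype n] [DecidableEq n] (B : Matrix n n R)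
    (s : Finset R) (hB : ∀ i j, B i j ∈ s) (N : ℕ) (b : R)
    (hs : ∀ l : List R, (∀ a ∈ l, a ∈ s) → l.length = N → b * l.prod = 0) (i j : n) :
    b * (B ^ N) i j = 0 := by
  induction N generalizing b i with
  | zero =>
    have hb : b = 0 := by simpa using hs [] (by simp) rfl
    rw [hb, zero_mul]
  | succ N ih =>
    rw [pow_succ', Matrix.mul_apply, Finset.mul_sum]
    refine Finset.sum_eq_zero fun k _ => ?_
    rw [← mul_assoc]
    refine ih _ (fun l hl hlen => ?_) k
    rw [mul_assoc, ← List.prod_cons]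
    exact hs _ (by simpa [hB] using hl) (by simp [hlen])

theorem IsArmendarizRing.isNilpotent_matrix {n : Type*} [Fintype n] [DecidableEq n]
    (hR : IsArmendarizRing R) (B : Matrix n n R) (hB : ∀ i j, IsNilpotent (B i j)) :
    IsNilpotent B := by
  classical
  obtain ⟨N, hN⟩ := hR.exists_list_prod_eq_zero
    (Finset.univ.image fun ij : n × n => B ij.1 ij.2) (by
      intro a ha
      obtain ⟨ij, -, rfl⟩ := Finset.mem_image.1 ha
      exact hB _ _)
  refine ⟨N, Matrix.ext fun i j => ?_⟩
  simpa using B.mul_pow_apply_eq_zero _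
    (fun i j => Finset.mem_image_of_mem (fun ij : n × n => B ij.1 ij.2) (Finset.mem_univ (i, j)))
    N 1 (by simpa using hN) i j

theorem IsArmendarizRing.commute_of_isIdempotentElem (hR : IsArmendarizRing R) {e : R}
    (he : IsIdempotentElem e) (r : R) : Commute e r := by
  have key : ∀ f : R, IsIdempotentElem f → f * r * (1 - f) = 0 := by
    intro f hf
    have hnil : IsNilpotent (f * r * (1 - f)) :=
      ⟨2, by rw [pow_two]; simp only [mul_assoc]; rw [← mul_assoc (1 - f) f, hf.one_sub_mul_self]
             simp⟩
    have h := hR.mul_mul_eq_zero hnil hf.mul_one_sub_self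
    rwa [mul_assoc f r, ← mul_assoc f f, hf.eq, mul_assoc f, mul_assoc r, hf.one_sub.eq,
      ← mul_assoc] at h
  have h₁ := key e he
  have h₂ := key (1 - e) he.one_sub
  have h : e * r - r * e = e * r * (1 - e) - (1 - e) * r * (1 - (1 - e)) := by noncomm_ring
  rw [h₁, h₂, sub_zero, sub_eq_zero] at h
  exact h

end Armendariz

section Jacobson

open Polynomial in
theorem Module.End.exists_hasEigenvalue_ne_of_pow_card_eq {F V : Type*} [Field F] [Fintype F]
    [AddCommGroup V] [Module F V] (T : Module.End F V) (hT : T ^ Fintype.card F = T) (μ : F)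
    (hμ : T ≠ algebraMap F (Module.End F V) μ) : ∃ ν, ν ≠ μ ∧ T.HasEigenvalue ν := by
  classical
  have hprod : ∏ ν : F, (X - C ν) = X ^ Fintype.card F - X := by
    have hcard : 1 < Fintype.card F := Fintype.one_lt_card
    have hroots := FiniteField.roots_X_pow_card_sub_X F
    have h := prod_multiset_X_sub_C_of_monic_of_roots_card_eq
      (p := (X ^ Fintype.card F - X : F[X]))
      (monic_X_pow_sub (by rw [degree_X]; exact_mod_cast hcard))
      (by rw [hroots, FiniteField.X_pow_card_sub_X_natDegree_eq F hcard]; rfl)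
    rwa [hroots] at h
  obtain ⟨v, hv⟩ : ∃ v, aeval T (X - C μ) v ≠ 0 := by
    by_contra! h
    refine hμ (LinearMap.ext fun v => ?_)
    have hv := h v
    rw [map_sub, aeval_X, aeval_C, LinearMap.sub_apply, sub_eq_zero] at hv
    exact hv
  have hzero : aeval T (∏ ν ∈ Finset.univ.erase μ, (X - C ν)) (aeval T (X - C μ) v) = 0 := by
    rw [← Module.End.mul_apply, ← map_mul, Finset.prod_erase_mul _ _ (Finset.mem_univ μ), hprod]
    simp [hT]
  have descend : ∀ (s : Finset F) (w : V), w ≠ 0 → aeval T (∏ ν ∈ s, (X - C ν)) w = 0 →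
      ∃ ν ∈ s, T.HasEigenvalue ν := by
    intro s
    induction s using Finset.induction_on with
    | empty => intro w hw h; simp [hw] at h
    | insert ν s hν ih =>
      intro w hw h
      rw [Finset.prod_insert hν, map_mul, Module.End.mul_apply] at h
      by_cases hs : aeval T (∏ ν ∈ s, (X - C ν)) w = 0
      · obtain ⟨ν', hν', h'⟩ := ih w hw hs
        exact ⟨ν', Finset.mem_insert_of_mem hν', h'⟩
      · refine ⟨ν, Finset.mem_insert_self _ _, Module.End.hasEigenvalue_of_hasEigenvector
          (x := aeval T (∏ ν ∈ s, (X - C ν)) w) ⟨Module.End.mem_eigenspace_iff.2 ?_, hs⟩⟩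
        rw [map_sub, aeval_X, aeval_C, LinearMap.sub_apply, sub_eq_zero] at h
        exact h
  obtain ⟨ν, hν, h⟩ := descend _ _ hv hzero
  exact ⟨ν, Finset.ne_of_mem_erase hν, h⟩

theorem exists_mul_eq_mul_of_not_commute {k D : Type*} [Field k] [Finite k] [Ring D] [IsDomain D]
    [Algebra k D] {a v : D} (ha : IsIntegral k a) (hv : v * a ≠ a * v) :
    ∃ b ∈ Algebra.adjoin k {a}, ∃ u : D, u ≠ 0 ∧ b ≠ a ∧ u * a = b * u := by
  have : IsMulCommutative (Algebra.adjoin k {a}) := Algebra.isMulCommutative_adjoin k (by simp)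
  have : Module.Finite k (Algebra.adjoin k {a}) :=
    Module.Finite.iff_fg.2 ha.fg_adjoin_singleton
  have : Finite (Algebra.adjoin k {a}) := Module.finite_of_finite k
  have : IsDomain (Algebra.adjoin k {a}) := inferInstance
  let : Field (Algebra.adjoin k {a}) := (Finite.isField_of_domain _).toField
  let := Fintype.ofFinite (Algebra.adjoin k {a})
  let α : Algebra.adjoin k {a} := ⟨a, Algebra.self_mem_adjoin_singleton k a⟩
  let T : Module.End (Algebra.adjoin k {a}) D := LinearMap.mulRight _ a
  obtain ⟨ν, hν, h⟩ := T.exists_hasEigenvalue_ne_of_pow_card_eq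
    (by
      rw [LinearMap.pow_mulRight]
      congr 1
      exact congrArg Subtype.val (FiniteField.pow_card α)) α
    (fun h => hv (LinearMap.congr_fun h v))
  obtain ⟨u, hu⟩ := h.exists_hasEigenvector
  exact ⟨ν, ν.2, u, hu.2, fun h => hν (Subtype.ext h), hu.apply_eq_smul⟩

theorem exists_finite_subalgebra_of_mul_eq_mul {k D : Type*} [Field k] [Finite k] [Ring D]
    [Algebra k D] {a b u : D} (ha : IsIntegral k a) (hu : IsIntegral k u)
    (hb : b ∈ Algebra.adjoin k {a}) (h : u * a = b * u) :
    ∃ S : Subalgebra k D, Finite S ∧ a ∈ S ∧ u ∈ S := by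
  set K := Algebra.adjoin k {a}
  set U := Algebra.adjoin k {u}
  have hswap : ∀ x ∈ K, ∃ y ∈ K, u * x = y * u := by
    intro x hx
    induction hx using Algebra.adjoin_induction with
    | mem x hx => exact ⟨b, hb, by rw [Set.mem_singleton_iff.1 hx, h]⟩
    | algebraMap r => exact ⟨_, K.algebraMap_mem r, (Algebra.commutes r u).symm⟩
    | add x y _ _ ihx ihy =>
      obtain ⟨x', hx', ex⟩ := ihx
      obtain ⟨y', hy', ey⟩ := ihy
      exact ⟨_, K.add_mem hx' hy', by rw [mul_add, add_mul, ex, ey]⟩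
    | mul x y _ _ ihx ihy =>
      obtain ⟨x', hx', ex⟩ := ihx
      obtain ⟨y', hy', ey⟩ := ihy
      exact ⟨_, K.mul_mem hx' hy', by rw [← mul_assoc, ex, mul_assoc, ey, mul_assoc]⟩
  let P := Subalgebra.toSubmodule K * Subalgebra.toSubmodule U
  have hKP : ∀ x ∈ K, ∀ y ∈ P, x * y ∈ P := by
    intro x hx y hy
    have := Submodule.mul_mem_mul (M := Subalgebra.toSubmodule K) hx hy
    rwa [← mul_assoc, Subalgebra.isIdempotentElem_toSubmodule] at this
  have huP : ∀ y ∈ P, u * y ∈ P := by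
    intro y hy
    induction hy using Submodule.mul_induction_on' with
    | mem_mul_mem m hm n hn =>
      obtain ⟨m', hm', e⟩ := hswap m hm
      rw [← mul_assoc, e, mul_assoc]
      exact Submodule.mul_mem_mul hm' (U.mul_mem (Algebra.self_mem_adjoin_singleton k u) hn)
    | add x _ y _ hx hy => rw [mul_add]; exact P.add_mem hx hy
  have hUP : ∀ x ∈ U, ∀ y ∈ P, x * y ∈ P := by
    intro x hx
    induction hx using Algebra.adjoin_induction with
    | mem x hx => rw [Set.mem_singleton_iff.1 hx]; exact huP
    | algebraMap r => intro y hy; rw [← Algebra.smul_def]; exact P.smul_mem r hy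
    | add x y _ _ ihx ihy =>
      intro z hz; rw [add_mul]; exact P.add_mem (ihx z hz) (ihy z hz)
    | mul x y _ _ ihx ihy => intro z hz; rw [mul_assoc]; exact ihx _ (ihy z hz)
  have hPP : ∀ x y, x ∈ P → y ∈ P → x * y ∈ P := by
    intro x y hx hy
    induction hx using Submodule.mul_induction_on' with
    | mem_mul_mem m hm n hn => rw [mul_assoc]; exact hKP m hm _ (hUP n hn y hy)
    | add x _ z _ hx hz => rw [add_mul]; exact P.add_mem hx hz
  have hone : (1 : D) ∈ P := by
    simpa using Submodule.mul_mem_mul (M := Subalgebra.toSubmodule K)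
      (N := Subalgebra.toSubmodule U) K.one_mem U.one_mem
  have : Module.Finite k P :=
    Module.Finite.iff_fg.2 (ha.fg_adjoin_singleton.mul hu.fg_adjoin_singleton)
  refine ⟨P.toSubalgebra hone hPP, (Module.finite_of_finite k : Finite P), ?_, ?_⟩
  · simpa using hKP a (Algebra.self_mem_adjoin_singleton k a) 1 hone
  · simpa using huP 1 hone

theorem mul_comm_of_isIntegral_of_finite (k : Type*) {D : Type*} [Field k] [Finite k] [Ring D]
    [IsDomain D] [Algebra k D] (hD : ∀ x : D, IsIntegral k x) (a v : D) : v * a = a * v := by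
  by_contra hv
  obtain ⟨b, hb, u, hu, hba, h⟩ := exists_mul_eq_mul_of_not_commute (hD a) hv
  obtain ⟨S, _, haS, huS⟩ := exists_finite_subalgebra_of_mul_eq_mul (hD a) (hD u) hb h
  have hcomm := congrArg Subtype.val
    ((Finite.isDomain_to_isField S).mul_comm ⟨u, huS⟩ ⟨a, haS⟩)
  exact hba (mul_right_cancel₀ hu (h.symm.trans hcomm))

/-- Jacobson's theorem for domains whose nonzero elements are roots of unity. -/
theorem mul_comm_of_exists_pow_eq_one {D : Type*} [Ring D] [IsDomain D]
    (hD : ∀ x : D, x ≠ 0 → ∃ k, 0 < k ∧ x ^ k = 1) (a b : D) : a * b = b * a := by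
  have hchar : ringChar D ≠ 0 := by
    intro h0
    have := (ringChar.eq_iff.1 h0 : CharP D 0)
    have := CharP.charP_to_charZero D
    obtain ⟨k, hk, h⟩ := hD 2 two_ne_zero
    have h' : (2 : ℕ) ^ k = 1 := by exact_mod_cast h
    exact absurd h' (Nat.one_lt_two_pow hk.ne').ne'
  have : Fact (ringChar D).Prime :=
    ⟨(CharP.char_is_prime_or_zero D (ringChar D)).resolve_right hchar⟩
  let := ZMod.algebra D (ringChar D)
  refine mul_comm_of_isIntegral_of_finite (ZMod (ringChar D)) (fun x => ?_) b a
  by_cases hx : x = 0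
  · exact hx ▸ isIntegral_zero
  · obtain ⟨k, hk, h⟩ := hD x hx
    exact IsIntegral.of_pow hk (h ▸ isIntegral_one)

end Jacobson

section Periodic

variable {R : Type*} [Ring R]

theorem IsPeriodicRing.exists_isIdempotentElem_pow (hR : IsPeriodicRing R) (x : R) :
    ∃ k, 0 < k ∧ IsIdempotentElem (x ^ k) := by
  obtain ⟨m, n, hn, hnm, h⟩ := hR x
  obtain ⟨d, rfl⟩ := Nat.exists_eq_add_of_lt hnm
  have hshift : ∀ j r : ℕ, x ^ (n + r + j * (d + 1)) = x ^ (n + r) := by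
    intro j r
    induction j with
    | zero => simp
    | succ j ih =>
      calc x ^ (n + r + (j + 1) * (d + 1)) = x ^ (n + d + 1) * x ^ (r + j * (d + 1)) := by
            rw [← pow_add]; congr 1; ring
        _ = x ^ (n + r) := by rw [h, ← pow_add, ← ih]; congr 1; ring
  refine ⟨n * (d + 1), by positivity, ?_⟩
  have hk : n * (d + 1) = n + n * d := by ring
  have := hshift n (n * d)
  rwa [← hk, pow_add] at this

theorem isNilpotent_of_mem_jacobson (hR : IsPeriodicRing R) {x : R}
    (hx : x ∈ Ring.jacobson R) : IsNilpotent x := by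
  obtain ⟨k, hk, he⟩ := hR.exists_isIdempotentElem_pow x
  have hmem : x ^ k ∈ Ring.jacobson R := Ideal.pow_mem_of_mem _ hx k hk
  rw [← Ideal.jacobson_bot, Ideal.mem_jacobson_iff] at hmem
  obtain ⟨z, hz⟩ := hmem (-1)
  have hz : z * (1 - x ^ k) = 1 := by
    rw [← sub_eq_zero, ← Submodule.mem_bot (R := R)]
    convert hz using 1
    noncomm_ring
  exact ⟨k, by rw [← one_mul (x ^ k), ← hz, mul_assoc, he.one_sub_mul_self, mul_zero]⟩

theorem mem_jacobson_of_isNilpotent (hR : IsPeriodicRing R)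
    (hcomm : ∀ e : R, IsIdempotentElem e → ∀ r, Commute e r) {x : R} (hx : IsNilpotent x) :
    x ∈ Ring.jacobson R := by
  rw [← Ideal.jacobson_bot, Ideal.mem_jacobson_iff]
  intro y
  have hyx : IsNilpotent (y * x) := by
    obtain ⟨k, hk, he⟩ := hR.exists_isIdempotentElem_pow (y * x)
    obtain ⟨k, rfl⟩ := Nat.exists_eq_succ_of_ne_zero hk.ne'
    obtain ⟨N, hN⟩ := hx
    have key : ∀ j, (y * x) ^ (k + 1) = ((y * x) ^ k * y) ^ j * (y * x) ^ (k + 1) * x ^ j := by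
      intro j
      induction j with
      | zero => simp
      | succ j ih =>
        calc (y * x) ^ (k + 1)
            = ((y * x) ^ k * y) ^ j * ((y * x) ^ (k + 1) * (y * x) ^ (k + 1)) * x ^ j := by
              rw [he.eq]; exact ih
          _ = ((y * x) ^ k * y) ^ j * ((y * x) ^ k * y * (x * (y * x) ^ (k + 1))) * x ^ j := by
              nth_rewrite 1 [pow_succ (y * x) k]; simp only [mul_assoc]
          _ = _ := by
              rw [← (hcomm _ he x).eq, pow_succ ((y * x) ^ k * y) j, pow_succ' x j]
              simp only [mul_assoc]
    exact ⟨k + 1, by rw [key N, hN, mul_zero]⟩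
  obtain ⟨u, hu⟩ := hyx.isUnit_one_add
  refine ⟨↑u⁻¹, ?_⟩
  have h : (↑u⁻¹ : R) * (1 + y * x) = 1 := hu ▸ u.inv_mul
  rw [Submodule.mem_bot, sub_eq_zero, ← h]
  noncomm_ring

theorem mul_one_sub_pow_mem_jacobson (hR : IsPeriodicRing R)
    (hcomm : ∀ e : R, IsIdempotentElem e → ∀ r, Commute e r) {x : R} {k : ℕ} (hk : 0 < k)
    (he : IsIdempotentElem (x ^ k)) : x * (1 - x ^ k) ∈ Ring.jacobson R := by
  refine mem_jacobson_of_isNilpotent hR hcomm ⟨k, ?_⟩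
  rw [(hcomm _ he.one_sub x).symm.mul_pow, he.one_sub.pow_eq hk.ne', he.mul_one_sub_self]

theorem isTwoSided_of_isMaximal (hR : IsPeriodicRing R)
    (hcomm : ∀ e : R, IsIdempotentElem e → ∀ r, Commute e r) (M : Ideal R) [M.IsMaximal] :
    M.IsTwoSided := by
  refine ⟨fun {x} r hx => ?_⟩
  obtain ⟨k, hk, he⟩ := hR.exists_isIdempotentElem_pow x
  have h₁ : x * (1 - x ^ k) * r ∈ M := Ring.jacobson_le_of_isMaximal M
    (Ideal.mul_mem_right r _ (mul_one_sub_pow_mem_jacobson hR hcomm hk he))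
  have h₂ : x * r * x ^ k ∈ M := M.mul_mem_left _ (M.pow_mem_of_mem hx k hk)
  have h : x * r = x * (1 - x ^ k) * r + x * r * x ^ k := by
    rw [mul_assoc x r, ← (hcomm _ he r).eq]
    noncomm_ring
  rw [h]
  exact M.add_mem h₁ h₂

theorem exists_one_sub_pow_mem_of_isMaximal (hR : IsPeriodicRing R)
    (hcomm : ∀ e : R, IsIdempotentElem e → ∀ r, Commute e r) (M : Ideal R) [hM : M.IsMaximal]
    {x : R} (hx : x ∉ M) : ∃ k, 0 < k ∧ 1 - x ^ k ∈ M := by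
  obtain ⟨k, hk, he⟩ := hR.exists_isIdempotentElem_pow x
  refine ⟨k, hk, ?_⟩
  have hxk : x ^ k ∉ M := by
    intro h
    refine hx ?_
    have h₁ := Ring.jacobson_le_of_isMaximal M (mul_one_sub_pow_mem_jacobson hR hcomm hk he)
    have h₂ := M.add_mem h₁ (M.mul_mem_left x h)
    rwa [← mul_add, sub_add_cancel, mul_one] at h₂
  obtain ⟨y, m, hm, hy⟩ := hM.exists_inv hxk
  have h : 1 - x ^ k = (1 - x ^ k) * m := by
    calc 1 - x ^ k = (1 - x ^ k) * (y * x ^ k + m) := by rw [hy, mul_one]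
      _ = (1 - x ^ k) * m := by
        rw [mul_add, (hcomm _ he y).symm.eq, ← mul_assoc, he.one_sub_mul_self, zero_mul, zero_add]
  rw [h]
  exact M.mul_mem_left _ hm

theorem mul_sub_mul_mem_jacobson (hR : IsPeriodicRing R)
    (hcomm : ∀ e : R, IsIdempotentElem e → ∀ r, Commute e r) (a b : R) :
    a * b - b * a ∈ Ring.jacobson R := by
  rw [Ring.jacobson_eq_sInf_isMaximal, Submodule.mem_sInf]
  intro M (hM : Ideal.IsMaximal M)
  have := isTwoSided_of_isMaximal hR hcomm M
  have hpow : ∀ x : R ⧸ M, x ≠ 0 → ∃ k, 0 < k ∧ x ^ k = 1 := by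
    intro x hx
    obtain ⟨x, rfl⟩ := Ideal.Quotient.mk_surjective x
    obtain ⟨k, hk, h⟩ := exists_one_sub_pow_mem_of_isMaximal hR hcomm M
      (mt Ideal.Quotient.eq_zero_iff_mem.2 hx)
    refine ⟨k, hk, ?_⟩
    rw [← Ideal.Quotient.eq_zero_iff_mem, map_sub, map_one, map_pow, sub_eq_zero] at h
    exact h.symm
  have : Nontrivial (R ⧸ M) := Ideal.Quotient.nontrivial_iff.2 hM.ne_top
  have : NoZeroDivisors (R ⧸ M) := by
    refine ⟨fun {x y} hxy => or_iff_not_imp_left.2 fun hx => ?_⟩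
    obtain ⟨k, hk, h⟩ := hpow x hx
    rw [← one_mul y, ← h, ← Nat.sub_add_cancel hk, pow_succ, mul_assoc, hxy, mul_zero]
  have : IsDomain (R ⧸ M) := NoZeroDivisors.to_isDomain _
  rw [← Ideal.Quotient.eq_zero_iff_mem, map_sub, map_mul, map_mul, sub_eq_zero]
  exact mul_comm_of_exists_pow_eq_one hpow _ _

theorem IsPeriodicRing.isIntegral (hR : IsPeriodicRing R) (x : R) : IsIntegral ℤ x := by
  obtain ⟨m, n, -, hnm, h⟩ := hR x
  refine ⟨Polynomial.X ^ m - Polynomial.X ^ n,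
    Polynomial.monic_X_pow_sub (by rw [Polynomial.degree_X_pow]; exact_mod_cast hnm), ?_⟩
  simp [h]

theorem IsPeriodicRing.exists_natCast_eq_zero (hR : IsPeriodicRing R) :
    ∃ q : ℕ, 0 < q ∧ (q : R) = 0 := by
  obtain ⟨m, n, -, hnm, h⟩ := hR 2
  have hlt : 2 ^ n < 2 ^ m := Nat.pow_lt_pow_right one_lt_two hnm
  refine ⟨2 ^ m - 2 ^ n, Nat.sub_pos_of_lt hlt, ?_⟩
  rw [Nat.cast_sub hlt.le]
  simp [h]

theorem isPeriodicRing_of_isIntegral {q : ℕ} (hq : 0 < q) (hqR : (q : R) = 0)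
    (hR : ∀ x : R, IsIntegral ℤ x) : IsPeriodicRing R := by
  intro x
  have : NeZero q := ⟨hq.ne'⟩
  let : Algebra (ZMod q) R := ZMod.algebra' R (ringChar R) (ringChar.dvd hqR)
  have hx : IsIntegral (ZMod q) x := (hR x).tower_top
  have : Module.Finite (ZMod q) (Algebra.adjoin (ZMod q) {x}) :=
    Module.Finite.iff_fg.2 hx.fg_adjoin_singleton
  have : Finite (Algebra.adjoin (ZMod q) {x}) := Module.finite_of_finite (ZMod q)
  let y : Algebra.adjoin (ZMod q) {x} := ⟨x, Algebra.self_mem_adjoin_singleton _ x⟩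
  obtain ⟨i, j, hij, h⟩ := Finite.exists_ne_map_eq_of_infinite fun i : ℕ => y ^ (i + 1)
  have h : x ^ (i + 1) = x ^ (j + 1) := congrArg Subtype.val h
  rcases hij.lt_or_gt with hlt | hlt
  · exact ⟨j + 1, i + 1, by omega, by omega, h.symm⟩
  · exact ⟨i + 1, j + 1, by omega, by omega, h⟩

theorem IsArmendarizRing.isIntegral_matrix {n : Type*} [Fintype n] [DecidableEq n]
    (hR : IsArmendarizRing R) (hper : IsPeriodicRing R) (A : Matrix n n R) : IsIntegral ℤ A := by
  let : CommRing (R ⧸ Ring.jacobson R) :=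
    { (inferInstance : Ring (R ⧸ Ring.jacobson R)) with
      mul_comm := by
        intro x y
        obtain ⟨x, rfl⟩ := Ideal.Quotient.mk_surjective x
        obtain ⟨y, rfl⟩ := Ideal.Quotient.mk_surjective y
        rw [← sub_eq_zero, ← map_mul, ← map_mul, ← map_sub, Ideal.Quotient.eq_zero_iff_mem]
        exact mul_sub_mul_mem_jacobson hper
          (fun _ he => hR.commute_of_isIdempotentElem he) x y }
  let φ : R →+* R ⧸ Ring.jacobson R := Ideal.Quotient.mk _
  have : Algebra.IsIntegral ℤ (R ⧸ Ring.jacobson R) := by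
    refine ⟨fun x => ?_⟩
    obtain ⟨x, rfl⟩ := Ideal.Quotient.mk_surjective x
    exact (hper.isIntegral x).map φ.toIntAlgHom
  obtain ⟨p, hp, hpA⟩ := isIntegral_trans (R := ℤ) (φ.mapMatrix A)
    (Matrix.isIntegral (φ.mapMatrix A))
  have hmap : φ.mapMatrix (Polynomial.aeval A p) = 0 := by
    rw [← hpA]
    exact (Polynomial.aeval_algHom_apply φ.mapMatrix.toIntAlgHom A p).symm
  obtain ⟨N, hN⟩ := hR.isNilpotent_matrix (Polynomial.aeval A p) fun i j =>
    isNilpotent_of_mem_jacobson hper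
      (Ideal.Quotient.eq_zero_iff_mem.1 (congrFun (congrFun hmap i) j))
  exact ⟨p ^ N, hp.pow N, by rw [← Polynomial.aeval_def, map_pow, hN]⟩

end Periodic

/-- If `R` is an Armendariz periodic ring, then the full matrix ring `Mₙ(R)` is
periodic for every `n ≥ 1`. -/
theorem periodic_matrix_of_armendariz (R : Type*) [Ring R]
    (harm : ∀ f g : Polynomial R, f * g = 0 → ∀ i j : ℕ, f.coeff i * g.coeff j = 0)
    (hper : IsPeriodicRing R) (n : ℕ) (hn : 0 < n) :
    IsPeriodicRing (Matrix (Fin n) (Fin n) R) := by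
  obtain ⟨q, hq, hqR⟩ := hper.exists_natCast_eq_zero
  refine isPeriodicRing_of_isIntegral hq ?_ (IsArmendarizRing.isIntegral_matrix harm hper)
  rw [← Matrix.diagonal_natCast, hqR, Matrix.diagonal_zero]
end

section
/- If R is a potent ring in which 3 is a unit, then for every positive integer n, every matrix A ∈ Mₙ(R) (Matrix (Fin n) (Fin n) R) can be written as A = E + P where E is an idempotent matrix (E^2 = E) and P is a potent matrix (P^m = P for some integer m ≥ 2). -/
/-- A ring `R` is *potent* if for every `x ∈ R` there is an integer `m ≥ 2`
with `x ^ m = x`. -/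
def IsPotentRing (R : Type*) [Ring R] : Prop :=
  ∀ x : R, ∃ m : ℕ, 2 ≤ m ∧ x ^ m = x

namespace IsPotentRing

variable {R : Type*} [Ring R]

theorem exists_pow_add_two (hR : IsPotentRing R) (x : R) : ∃ k : ℕ, x ^ (k + 2) = x := by
  obtain ⟨m, hm, hx⟩ := hR x
  obtain ⟨k, rfl⟩ := Nat.exists_eq_add_of_le' hm
  exact ⟨k, hx⟩

theorem of_surjective {S : Type*} [Ring S] (hR : IsPotentRing R) (f : R →+* S)
    (hf : Function.Surjective f) : IsPotentRing S := by
  intro y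
  obtain ⟨x, rfl⟩ := hf y
  obtain ⟨m, hm, hx⟩ := hR x
  exact ⟨m, hm, by rw [← map_pow, hx]⟩

theorem eq_zero_of_mul_self_eq_zero (hR : IsPotentRing R) {x : R} (hx : x * x = 0) : x = 0 := by
  obtain ⟨k, hk⟩ := hR.exists_pow_add_two x
  rw [← hk, pow_add, pow_two, hx, mul_zero]

theorem commute_of_isIdempotentElem (hR : IsPotentRing R) {e : R} (he : e * e = e) (x : R) :
    e * x = x * e := by
  have h1 : e * x - e * x * e = 0 := by
    apply hR.eq_zero_of_mul_self_eq_zero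
    calc (e * x - e * x * e) * (e * x - e * x * e)
        = e * x * e * x - e * x * e * x * e - e * x * (e * e) * x
          + e * x * (e * e) * x * e := by noncomm_ring
      _ = 0 := by rw [he]; noncomm_ring
  have h2 : x * e - e * x * e = 0 := by
    apply hR.eq_zero_of_mul_self_eq_zero
    calc (x * e - e * x * e) * (x * e - e * x * e)
        = x * e * x * e - x * (e * e) * x * e - e * x * e * x * e
          + e * x * (e * e) * x * e := by noncomm_ring
      _ = 0 := by rw [he]; noncomm_ring
  rw [sub_eq_zero.mp h1, sub_eq_zero.mp h2]

theorem pow_succ_mul_self {x : R} {k : ℕ} (hk : x ^ (k + 2) = x) :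
    x ^ (k + 1) * x ^ (k + 1) = x ^ (k + 1) := by
  calc x ^ (k + 1) * x ^ (k + 1) = x ^ k * x ^ (k + 2) := by
        rw [← pow_add, ← pow_add]; congr 1; omega
    _ = x ^ (k + 1) := by rw [hk, pow_succ]

theorem isTwoSided (hR : IsPotentRing R) (I : Ideal R) : I.IsTwoSided := by
  refine ⟨fun {x} r hx => ?_⟩
  obtain ⟨k, hk⟩ := hR.exists_pow_add_two x
  have hcomm := hR.commute_of_isIdempotentElem (pow_succ_mul_self hk) r
  have : x * r = x * r * x ^ k * x := by
    calc x * r = x ^ (k + 2) * r := by rw [hk]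
      _ = x * (x ^ (k + 1) * r) := by rw [← mul_assoc, ← pow_succ']
      _ = x * r * x ^ k * x := by rw [hcomm, pow_succ]; simp only [mul_assoc]
  rw [this]
  exact I.mul_mem_left _ hx

theorem exists_natCast_eq_zero (hR : IsPotentRing R) : ∃ N : ℕ, 0 < N ∧ (N : R) = 0 := by
  obtain ⟨k, hk⟩ := hR.exists_pow_add_two (2 : R)
  have hle : 2 < 2 ^ (k + 2) :=
    calc 2 = 2 ^ 1 := rfl
      _ < 2 ^ (k + 2) := Nat.pow_lt_pow_right (by norm_num) (by omega)
  refine ⟨2 ^ (k + 2) - 2, by omega, ?_⟩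
  rw [Nat.cast_sub hle.le]
  push_cast
  rw [hk, sub_self]

theorem isIntegral (hR : IsPotentRing R) (x : R) : IsIntegral ℤ x := by
  obtain ⟨k, hk⟩ := hR.exists_pow_add_two x
  refine ⟨Polynomial.X ^ (k + 2) - Polynomial.X,
    Polynomial.monic_X_pow_sub (by rw [Polynomial.degree_X]; norm_cast; omega), ?_⟩
  simp [hk]

theorem finite_of_fg (hR : IsPotentRing R) {S : Subalgebra ℤ R}
    (hS : (Subalgebra.toSubmodule S).FG) : Finite S := by
  obtain ⟨N, hN, hN0⟩ := hR.exists_natCast_eq_zero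
  have : Module.Finite ℤ S := Module.Finite.iff_fg.mpr hS
  refine Module.finite_of_fg_torsion S fun x => ⟨⟨(N : ℤ), ?_⟩, ?_⟩
  · exact mem_nonZeroDivisors_of_ne_zero (by exact_mod_cast hN.ne')
  · ext
    simp [hN0]

end IsPotentRing

/-- If `s` is a finite set of scalars and `∏ c ∈ s, (f - c)` kills a nonzero vector, then some
`c ∈ s` is an eigenvalue of `f`. -/
theorem exists_apply_eq_smul_of_prod_apply_eq_zero {K V : Type*} [CommRing K] [AddCommGroup V]
    [Module K V] (f : Module.End K V) (s : Finset K) {v : V} (hv : v ≠ 0)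
    (h : Polynomial.aeval f (∏ c ∈ s, (Polynomial.X - Polynomial.C c)) v = 0) :
    ∃ c ∈ s, ∃ w ≠ 0, f w = c • w := by
  classical
  induction s using Finset.induction_on with
  | empty => simp [hv] at h
  | insert c s hc ih =>
    rw [Finset.prod_insert hc, map_mul, Module.End.mul_apply] at h
    by_cases hw : Polynomial.aeval f (∏ c ∈ s, (Polynomial.X - Polynomial.C c)) v = 0
    · obtain ⟨d, hd, w, hw⟩ := ih hw
      exact ⟨d, Finset.mem_insert_of_mem hd, w, hw⟩
    · refine ⟨c, Finset.mem_insert_self c s, _, hw, ?_⟩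
      simpa [sub_eq_zero] using h

/-- In a domain, an element `a` of a finite commutative subring that is not central
is twisted by some nonzero `b` into another element of the subring. -/
theorem exists_mul_eq_mul_of_not_commute_s12 {D : Type*} [Ring D] [IsDomain D]
    (K : Subalgebra ℤ D) [Finite K] (a : K) {x : D} (hx : x * a ≠ a * x) :
    ∃ c : K, c ≠ a ∧ ∃ b : D, b ≠ 0 ∧ b * a = c * b := by
  classical
  cases nonempty_fintype K
  let _ : Field K := (Finite.isDomain_to_isField K).toField
  let f : Module.End K D := LinearMap.mulRight K (a : D)
  have hpow : ∀ n : ℕ, ∀ y : D, (f ^ n) y = y * (a : D) ^ n := by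
    intro n
    induction n with
    | zero => simp
    | succ n ih => intro y; rw [pow_succ, Module.End.mul_apply, ih, pow_succ', ← mul_assoc]; rfl
  have hprod : ∏ c : K, (Polynomial.X - Polynomial.C c)
      = Polynomial.X ^ Fintype.card K - Polynomial.X := by
    have h := Polynomial.prod_multiset_X_sub_C_of_monic_of_roots_card_eq
      (p := (Polynomial.X ^ Fintype.card K - Polynomial.X : Polynomial K))
      (Polynomial.monic_X_pow_sub (by
        rw [Polynomial.degree_X]; exact_mod_cast Fintype.one_lt_card))
      (by rw [FiniteField.roots_X_pow_card_sub_X,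
          FiniteField.X_pow_card_sub_X_natDegree_eq K Fintype.one_lt_card]; rfl)
    rw [FiniteField.roots_X_pow_card_sub_X] at h
    exact h
  have hcard : (a : D) ^ Fintype.card K = a := by
    exact_mod_cast congrArg Subtype.val (FiniteField.pow_card a)
  have hzero : Polynomial.aeval f
      (∏ c ∈ Finset.univ.erase a, (Polynomial.X - Polynomial.C c)) (x * a - a * x) = 0 := by
    have h := congrArg (fun p => Polynomial.aeval f p x) hprod
    rw [← Finset.prod_erase_mul _ _ (Finset.mem_univ a)] at h
    simp only [map_mul, Module.End.mul_apply] at h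
    have hx' : Polynomial.aeval f (Polynomial.X - Polynomial.C a) x = x * a - a * x := by
      rw [map_sub, Polynomial.aeval_X, Polynomial.aeval_C]
      rfl
    rw [hx'] at h
    rw [h, map_sub, map_pow, Polynomial.aeval_X, LinearMap.sub_apply, hpow, hcard]
    exact sub_self _
  obtain ⟨c, hc, b, hb, hbc⟩ :=
    exists_apply_eq_smul_of_prod_apply_eq_zero f _ (sub_ne_zero.mpr hx) hzero
  exact ⟨c, Finset.ne_of_mem_erase hc, b, hb, hbc⟩

/-- A finite commutative subring `K` and a potent element `b` with `b K ⊆ K b` generate a finite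
ring; so in a domain they commute. -/
theorem commute_of_mul_mem {D : Type*} [Ring D] [IsDomain D] (K : Subalgebra ℤ D) [Finite K]
    {b : D} {k : ℕ} (hb : b ^ (k + 2) = b) (h : ∀ c : K, ∃ d : K, b * c = d * b) (a : K) :
    b * a = a * b := by
  cases nonempty_fintype K
  let _ : Field K := (Finite.isDomain_to_isField K).toField
  let M : Submodule K D := Submodule.span K (Set.range fun i : ℕ => b ^ i)
  have hpow : ∀ i : ℕ, ∀ c : K, ∃ d : K, b ^ i * c = d * b ^ i := by
    intro i
    induction i with
    | zero => exact fun c => ⟨c, by simp⟩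
    | succ i ih =>
      intro c
      obtain ⟨d, hd⟩ := h c
      obtain ⟨e, he⟩ := ih d
      exact ⟨e, by rw [pow_succ, mul_assoc, hd, ← mul_assoc, he, mul_assoc]⟩
  have hmem : ∀ i, b ^ i ∈ M := fun i => Submodule.subset_span ⟨i, rfl⟩
  have hmul : ∀ {x y : D}, x ∈ M → y ∈ M → x * y ∈ M := by
    intro x y hx hy
    induction hx using Submodule.span_induction with
    | zero => rw [zero_mul]; exact M.zero_mem
    | add x x' _ _ hx hx' => rw [add_mul]; exact M.add_mem hx hx'
    | smul c x _ hx => rw [smul_mul_assoc]; exact M.smul_mem c hx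
    | mem x hx =>
      obtain ⟨i, rfl⟩ := hx
      dsimp only
      induction hy using Submodule.span_induction with
      | zero => rw [mul_zero]; exact M.zero_mem
      | add y y' _ _ hy hy' => rw [mul_add]; exact M.add_mem hy hy'
      | mem y hy =>
        obtain ⟨j, rfl⟩ := hy
        dsimp only
        rw [← pow_add]
        exact hmem _
      | smul c y _ hy =>
        obtain ⟨d, hd⟩ := hpow i c
        have : b ^ i * (c • y) = d • (b ^ i * y) := by
          change b ^ i * ((c : D) * y) = (d : D) * (b ^ i * y)
          rw [← mul_assoc, hd, mul_assoc]
        rw [this]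
        exact M.smul_mem d hy
  have hfin : (Set.range fun i : ℕ => b ^ i).Finite := by
    refine ((Set.finite_lt_nat (k + 2)).image fun i => b ^ i).subset ?_
    rintro _ ⟨i, rfl⟩
    induction i using Nat.strong_induction_on with
    | _ i ih =>
      by_cases hi : i < k + 2
      · exact ⟨i, hi, rfl⟩
      · have : b ^ i = b ^ (i - (k + 1)) := by
          obtain ⟨j, rfl⟩ := Nat.exists_eq_add_of_le' (not_lt.mp hi)
          rw [pow_add, hb, ← pow_succ]
          congr 1
          omega
        dsimp only
        rw [this]
        exact ih _ (by omega)
  have hMfin : Finite M := by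
    have : Module.Finite K M := Module.Finite.span_of_finite K hfin
    exact Module.finite_of_finite K
  let S : Subring D :=
    { carrier := M
      mul_mem' := hmul
      one_mem' := by simpa using hmem 0
      add_mem' := M.add_mem
      zero_mem' := M.zero_mem
      neg_mem' := M.neg_mem }
  have : Finite S := hMfin
  have haS : (a : D) ∈ S := by
    have : a • b ^ 0 ∈ M := M.smul_mem a (hmem 0)
    rwa [pow_zero, show a • (1 : D) = (a : D) from mul_one _] at this
  have hbS : b ∈ S := (pow_one b ▸ hmem 1 : b ∈ M)
  exact congrArg Subtype.val ((Finite.isDomain_to_isField S).mul_comm ⟨b, hbS⟩ ⟨a, haS⟩)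

namespace IsPotentRing

theorem mul_comm_of_isDomain {D : Type*} [Ring D] [IsDomain D] (hD : IsPotentRing D) (x a : D) :
    x * a = a * x := by
  by_contra hx
  let K : Subalgebra ℤ D := Algebra.adjoin ℤ {a}
  have : Finite K := hD.finite_of_fg (hD.isIntegral a).fg_adjoin_singleton
  let a' : K := ⟨a, Algebra.self_mem_adjoin_singleton ℤ a⟩
  obtain ⟨c, hc, b, hb, hbc⟩ := exists_mul_eq_mul_of_not_commute_s12 K a' hx
  have hK : ∀ d : K, ∃ e : K, b * d = e * b := by
    rintro ⟨d, hd⟩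
    induction hd using Algebra.adjoin_induction with
    | mem y hy =>
      rw [Set.mem_singleton_iff] at hy
      exact ⟨c, by rw [← hbc]; simp [hy, a']⟩
    | algebraMap r => exact ⟨algebraMap ℤ K r, (Algebra.commutes r b).symm⟩
    | add y z _ _ hy hz =>
      obtain ⟨e, he⟩ := hy
      obtain ⟨f, hf⟩ := hz
      refine ⟨e + f, ?_⟩
      dsimp only at he hf ⊢
      rw [mul_add, he, hf, ← add_mul]
      rfl
    | mul y z _ _ hy hz =>
      obtain ⟨e, he⟩ := hy
      obtain ⟨f, hf⟩ := hz
      refine ⟨e * f, ?_⟩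
      dsimp only at he hf ⊢
      rw [← mul_assoc, he, mul_assoc, hf, ← mul_assoc]
      rfl
  obtain ⟨k, hk⟩ := hD.exists_pow_add_two b
  have h := commute_of_mul_mem K hk hK a'
  rw [hbc] at h
  exact hc (Subtype.ext (mul_right_cancel₀ hb h))

/-- **Jacobson's theorem**: a potent ring is commutative. -/
theorem mul_comm {R : Type*} [Ring R] (hR : IsPotentRing R) (x y : R) : x * y = y * x := by
  by_contra hxy
  obtain ⟨k, hk⟩ := hR.exists_pow_add_two (x * y - y * x)
  set z := x * y - y * x with hz
  have hz0 : z ≠ 0 := sub_ne_zero.mpr hxy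
  have hne : Ideal.span {1 - z ^ (k + 1)} ≠ ⊤ := by
    intro htop
    obtain ⟨r, hr⟩ := Ideal.mem_span_singleton'.mp ((Ideal.eq_top_iff_one _).mp htop)
    apply hz0
    calc z = r * (1 - z ^ (k + 1)) * z := by rw [hr, one_mul]
      _ = r * (z - z ^ (k + 2)) := by rw [mul_assoc, sub_mul, one_mul, ← pow_succ]
      _ = 0 := by rw [hk, sub_self, mul_zero]
  obtain ⟨I, hI, hle⟩ := Ideal.exists_le_maximal _ hne
  have := hR.isTwoSided I
  have : IsDomain (R ⧸ I) := (Ideal.Quotient.divisionRing I).isDomain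
  have hcomm := (hR.of_surjective (Ideal.Quotient.mk I)
    Ideal.Quotient.mk_surjective).mul_comm_of_isDomain
    (Ideal.Quotient.mk I x) (Ideal.Quotient.mk I y)
  have hzI : z ∈ I := by
    rw [← Ideal.Quotient.eq_zero_iff_mem, hz, map_sub, map_mul, map_mul, hcomm, sub_self]
  have h1 : 1 - z ^ (k + 1) ∈ I := hle (Ideal.mem_span_singleton_self _)
  have h2 : z ^ (k + 1) ∈ I := by rw [pow_succ]; exact I.mul_mem_left _ hzI
  exact hI.ne_top ((Ideal.eq_top_iff_one I).mpr (by simpa using I.add_mem h1 h2))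

end IsPotentRing

theorem exists_pow_isIdempotentElem_of_finite {M : Type*} [Monoid M] [Finite M] (a : M) :
    ∃ k : ℕ, 0 < k ∧ IsIdempotentElem (a ^ k) := by
  obtain ⟨i, j, hij, h⟩ := Finite.exists_ne_map_eq_of_infinite (fun n : ℕ => a ^ n)
  wlog hlt : i < j generalizing i j
  · exact this j i hij.symm h.symm (by omega)
  obtain ⟨d, rfl⟩ := Nat.exists_eq_add_of_lt hlt
  have hstep : ∀ n, i ≤ n → ∀ t, a ^ (n + t * (d + 1)) = a ^ n := by
    intro n hn t
    obtain ⟨l, rfl⟩ := Nat.exists_eq_add_of_le hn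
    induction t with
    | zero => simp
    | succ t ih =>
      calc a ^ (i + l + (t + 1) * (d + 1))
          = a ^ (i + d + 1) * a ^ (l + t * (d + 1)) := by
            rw [← pow_add]; congr 1; ring
        _ = a ^ (i + l) := by
            rw [← show a ^ i = a ^ (i + d + 1) from h, ← pow_add, ← add_assoc, ih]
  refine ⟨(i + 1) * (d + 1), by positivity, ?_⟩
  rw [IsIdempotentElem, ← pow_add]
  exact hstep _ (by nlinarith) _

/-- Every element `a` of a finite ring is the sum of an idempotent and a unit of finite order:
if `a ^ k` is idempotent, then `1 - a ^ k` is a suitable idempotent. -/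
theorem exists_idempotent_add_potent_of_finite {S : Type*} [Ring S] [Finite S] (a : S) :
    ∃ e p : S, a = e + p ∧ e ^ 2 = e ∧ ∃ m : ℕ, 2 ≤ m ∧ p ^ m = p := by
  obtain ⟨k, hk, he⟩ := exists_pow_isIdempotentElem_of_finite a
  set p := a - (1 - a ^ k) with hp
  have hreg : ∀ y, p * y = 0 → y = 0 := by
    intro y hy
    have hy' : a * y = y - a ^ k * y := by
      rw [hp, sub_mul, sub_mul, one_mul, sub_eq_zero] at hy
      exact hy
    have h1 : a ^ k * (a * y) = 0 := by
      rw [hy', mul_sub, ← mul_assoc, he.eq, sub_self]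
    have h2 : a ^ k * y = 0 := by
      obtain ⟨l, rfl⟩ := Nat.exists_eq_add_of_lt hk
      rw [zero_add] at *
      calc a ^ (l + 1) * y = a ^ (l + 1) * a ^ (l + 1) * y := by rw [he.eq]
        _ = a ^ l * (a ^ (l + 1) * (a * y)) := by
          simp only [← mul_assoc, ← pow_add, ← pow_succ]
          congr 2
          omega
        _ = 0 := by rw [h1, mul_zero]
    have h3 : ∀ j : ℕ, a ^ j * y = y := by
      intro j
      induction j with
      | zero => simp
      | succ j ih => rw [pow_succ, mul_assoc, hy', h2, sub_zero, ih]
    rw [← h3 k, h2]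
  have hregpow : ∀ j : ℕ, ∀ y, p ^ j * y = 0 → y = 0 := by
    intro j
    induction j with
    | zero => simp
    | succ j ih => exact fun y hy => hreg y (ih _ (by rwa [← mul_assoc, ← pow_succ]))
  obtain ⟨j, hj, hjp⟩ := exists_pow_isIdempotentElem_of_finite p
  have hone : p ^ j = 1 :=
    sub_eq_zero.mp (hregpow j _ (by rw [mul_sub, mul_one, hjp.eq, sub_self]))
  refine ⟨1 - a ^ k, p, by rw [hp]; abel, by rw [pow_two]; exact he.one_sub, j + 1, by omega, ?_⟩
  rw [pow_succ, hone, one_mul]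

theorem IsPotentRing.matrix_eq_idempotent_add_potent {R ι : Type*} [CommRing R] [Fintype ι]
    [DecidableEq ι] (hR : IsPotentRing R) (A : Matrix ι ι R) :
    ∃ E P : Matrix ι ι R, A = E + P ∧ E ^ 2 = E ∧ ∃ m : ℕ, 2 ≤ m ∧ P ^ m = P := by
  let s : Set R := Set.range fun ij : ι × ι => A ij.1 ij.2
  let S : Subalgebra ℤ R := Algebra.adjoin ℤ s
  have : Finite S := hR.finite_of_fg
    (fg_adjoin_of_finite (Set.finite_range _) fun x _ => hR.isIntegral x)
  let B : Matrix ι ι S := .of fun i j => ⟨A i j, Algebra.subset_adjoin ⟨(i, j), rfl⟩⟩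
  let f : Matrix ι ι S →+* Matrix ι ι R := S.val.toRingHom.mapMatrix
  have hB : f B = A := rfl
  have : Finite (Matrix ι ι S) := inferInstanceAs (Finite (ι → ι → S))
  obtain ⟨E, P, hEP, hE, m, hm, hP⟩ := exists_idempotent_add_potent_of_finite B
  exact ⟨f E, f P, by rw [← map_add, ← hEP, hB], by rw [← map_pow, hE], m, hm,
    by rw [← map_pow, hP]⟩

/-- If `R` is a potent ring in which `3` is a unit, then every matrix in `Mₙ(R)` is
the sum of an idempotent and a potent, for all `n ≥ 1`. -/
theorem matrix_eq_idempotent_add_potent_of_potent (R : Type*) [Ring R]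
    (hR : IsPotentRing R) (h3 : IsUnit (3 : R)) (n : ℕ) (hn : 0 < n)
    (A : Matrix (Fin n) (Fin n) R) :
    ∃ E P : Matrix (Fin n) (Fin n) R,
      A = E + P ∧ E ^ 2 = E ∧ ∃ m : ℕ, 2 ≤ m ∧ P ^ m = P := by
  let _ : CommRing R := { ‹Ring R› with mul_comm := hR.mul_comm }
  exact IsPotentRing.matrix_eq_idempotent_add_potent hR A
end

section
/- Let k be a commutative ring and let A and B be k-algebras which, as rings, are weakly 2-primal (the set of nilpotent elements is a two-sided ideal which is locally nilpotent: for every finite subset S of nilpotents there exists a positive integer N such that every product of N elements of S equals 0) and periodic. Then the tensor product algebra A ⊗[k] B is a periodic ring. -/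
open scoped TensorProduct

/-- A ring `R` is *weakly 2-primal* if the set of nilpotent elements of `R` is a
two-sided ideal which is locally nilpotent: for every finite subset `S` of nilpotents,
there is a positive integer `N` such that every product of `N` elements of `S` is `0`. -/
def IsWeakly2Primal (R : Type*) [Ring R] : Prop :=
  (∃ I : TwoSidedIdeal R, ∀ x : R, x ∈ I ↔ IsNilpotent x) ∧
  (∀ S : Finset R, (∀ x ∈ S, IsNilpotent x) →
    ∃ N : ℕ, 0 < N ∧ ∀ l : List R, (∀ x ∈ l, x ∈ S) → l.length = N → l.prod = 0)

theorem IsReduced.pow_succ_eq_self {R : Type*} [Ring R] [IsReduced R] {x : R} {n d : ℕ}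
    (h : x ^ (n + d) = x ^ n) : x ^ (d + 1) = x := by
  have hc : x ^ (d + 1) - x = x * (x ^ d - 1) := by
    rw [mul_sub, ← pow_succ', mul_one]
  have hx : Commute x (x ^ d - 1) := ((Commute.refl x).pow_right d).sub_right (.one_right x)
  rw [← sub_eq_zero]
  refine IsReduced.eq_zero _ ⟨n + 1, ?_⟩
  rw [hc, hx.mul_pow, pow_succ' x, pow_succ' (_ - _), mul_assoc, ← mul_assoc (x ^ n), mul_sub,
    ← pow_add, h, mul_one, sub_self, zero_mul, mul_zero]

section Domain

variable {D : Type*} [Ring D] [IsDomain D]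

open Polynomial in
theorem exists_mul_sub_mul_eq_of_finite_adjoin {p : ℕ} [Fact p.Prime] [Algebra (ZMod p) D]
    {x z : D} [Finite (Algebra.adjoin (ZMod p) {x})] (hxz : x * z ≠ z * x) :
    ∃ c ∈ Algebra.adjoin (ZMod p) {x}, c ≠ 0 ∧ ∃ y : D, y ≠ 0 ∧ x * y - y * x = c * y := by
  set F := Algebra.adjoin (ZMod p) {x}
  let : Field F := (Finite.isDomain_to_isField F).toField
  let : Fintype F := Fintype.ofFinite F
  let X' : F := ⟨x, Algebra.self_mem_adjoin_singleton _ x⟩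
  have : CharP F p := charP_of_injective_algebraMap (algebraMap (ZMod p) F).injective p
  obtain ⟨n, -, hn⟩ := FiniteField.card F p
  let δ : Module.End F D := algebraMap F (Module.End F D) X' - LinearMap.mulRight F x
  have hδ (y : D) : δ y = x * y - y * x := rfl
  have : CharP (Module.End F D) p :=
    charP_of_injective_algebraMap (algebraMap F (Module.End F D)).injective p
  have hpow : δ ^ Fintype.card F = δ := by
    have hX : X' ^ Fintype.card F = X' := FiniteField.pow_card X'
    have hx : x ^ Fintype.card F = x := congrArg Subtype.val hX
    have hcomm : Commute (algebraMap F (Module.End F D) X') (LinearMap.mulRight F x) :=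
      Algebra.commutes _ _
    have := sub_pow_char_pow_of_commute (p := p) (n := n) hcomm
    rw [← hn, ← map_pow, hX, LinearMap.pow_mulRight, hx] at this
    exact this
  by_contra! hcon
  have hinj (c : F) (hc : c ≠ 0) : Function.Injective (aeval δ (X - C c)) := by
    rw [← LinearMap.ker_eq_bot, LinearMap.ker_eq_bot']
    intro y hy
    by_contra hy0
    refine hcon c c.2 (by simpa using hc) y hy0 ?_
    rw [← hδ, ← sub_eq_zero]
    simpa [Subalgebra.smul_def] using hy
  have hprod (s : Finset F) (hs : (0 : F) ∉ s) :
      Function.Injective (aeval δ (∏ c ∈ s, (X - C c))) := by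
    classical
    induction s using Finset.induction_on with
    | empty => simpa using! Function.injective_id
    | insert a s ha ih =>
      rw [Finset.mem_insert, not_or] at hs
      rw [Finset.prod_insert ha, map_mul]
      exact (hinj a (Ne.symm hs.1)).comp (ih hs.2)
  classical
  have hsplit : (∏ c ∈ Finset.univ.erase (0 : F), (X - C c)) * X = X ^ Fintype.card F - X := by
    have h1 : (∏ c : F, (X - C c)) = X ^ Fintype.card F - X := by
      have := (FiniteField.X_pow_card_sub_X_natDegree_eq F (Fintype.one_lt_card (α := F)))
      have h2 := prod_multiset_X_sub_C_of_monic_of_roots_card_eq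
        (p := (X ^ Fintype.card F - X : F[X]))
        (monic_X_pow_sub (by simpa using Fintype.one_lt_card (α := F)))
        (by rw [FiniteField.roots_X_pow_card_sub_X, this]; rfl)
      rw [FiniteField.roots_X_pow_card_sub_X] at h2
      exact h2
    rw [← h1, ← Finset.prod_erase_mul _ _ (Finset.mem_univ (0 : F)), map_zero, sub_zero]
  have hzero : aeval δ ((∏ c ∈ Finset.univ.erase (0 : F), (X - C c)) * X) = 0 := by
    rw [hsplit, map_sub, map_pow, aeval_X, hpow, sub_self]
  rw [map_mul, aeval_X] at hzero
  have := hprod _ (Finset.notMem_erase 0 _) ((LinearMap.congr_fun hzero z).trans (map_zero _).symm)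
  rw [hδ] at this
  exact hxz (sub_eq_zero.mp this)

theorem commute_of_mul_sub_mul_eq {K : Type*} [Field K] [Finite K] [Algebra K D] {x y c : D}
    [Finite (Algebra.adjoin K {x})] (hc : c ∈ Algebra.adjoin K {x})
    (hxy : x * y - y * x = c * y) {d : ℕ} (hd : 0 < d) (hy : y ^ d = 1) : x * y = y * x := by
  set F := Algebra.adjoin K {x}
  have hxF : x ∈ F := Algebra.self_mem_adjoin_singleton _ x
  have hswap : ∀ f ∈ F, ∃ g ∈ F, y * f = g * y := by
    intro f hf
    induction hf using Algebra.adjoin_induction with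
    | mem f hf =>
      rw [Set.mem_singleton_iff] at hf
      subst hf
      exact ⟨f - c, sub_mem hxF hc, by rw [sub_mul, ← hxy]; abel⟩
    | algebraMap r => exact ⟨_, F.algebraMap_mem r, (Algebra.commutes r y).symm⟩
    | add a b _ _ ha hb =>
      obtain ⟨a', ha', ha⟩ := ha
      obtain ⟨b', hb', hb⟩ := hb
      exact ⟨a' + b', add_mem ha' hb', by rw [mul_add, ha, hb, add_mul]⟩
    | mul a b _ _ ha hb =>
      obtain ⟨a', ha', ha⟩ := ha
      obtain ⟨b', hb', hb⟩ := hb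
      exact ⟨a' * b', mul_mem ha' hb', by rw [← mul_assoc, ha, mul_assoc, hb, mul_assoc]⟩
  have hswap_pow (j : ℕ) : ∃ g ∈ F, y ^ j * x = g * y ^ j := by
    induction j with
    | zero => exact ⟨x, hxF, by simp⟩
    | succ j ih =>
      obtain ⟨g, hg, h⟩ := ih
      obtain ⟨g', hg', h'⟩ := hswap g hg
      exact ⟨g', hg', by rw [pow_succ', mul_assoc, h, ← mul_assoc, h', mul_assoc]⟩
  let U : Submodule F D := Submodule.span F (Set.range fun j : ℕ => y ^ j)
  have hpow (j : ℕ) : y ^ j ∈ U := Submodule.subset_span ⟨j, rfl⟩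
  have hUF (g : D) (hg : g ∈ F) (u : D) (hu : u ∈ U) : g * u ∈ U :=
    U.smul_mem (⟨g, hg⟩ : F) hu
  have hUx (u : D) (hu : u ∈ U) : u * x ∈ U := by
    induction hu using Submodule.span_induction with
    | mem u hu =>
      obtain ⟨j, rfl⟩ := hu
      obtain ⟨g, hg, h⟩ := hswap_pow j
      simpa only [h] using hUF g hg _ (hpow j)
    | zero => simp
    | add a b _ _ ha hb => rw [add_mul]; exact add_mem ha hb
    | smul r a _ ha => rw [smul_mul_assoc]; exact U.smul_mem r ha
  have hUy (u : D) (hu : u ∈ U) : u * y ∈ U := by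
    induction hu using Submodule.span_induction with
    | mem u hu =>
      obtain ⟨j, rfl⟩ := hu
      simpa only [pow_succ] using hpow (j + 1)
    | zero => simp
    | add a b _ _ ha hb => rw [add_mul]; exact add_mem ha hb
    | smul r a _ ha => rw [smul_mul_assoc]; exact U.smul_mem r ha
  have hUadj (z : D) (hz : z ∈ Algebra.adjoin K {x, y}) : ∀ u ∈ U, u * z ∈ U := by
    induction hz using Algebra.adjoin_induction with
    | mem z hz =>
      rcases hz with rfl | hz
      · exact hUx
      · rw [Set.mem_singleton_iff] at hz
        subst hz
        exact hUy
    | algebraMap r =>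
      intro u hu
      rw [← Algebra.commutes]
      exact hUF _ (F.algebraMap_mem r) u hu
    | add a b _ _ ha hb => intro u hu; rw [mul_add]; exact add_mem (ha u hu) (hb u hu)
    | mul a b _ _ ha hb => intro u hu; rw [← mul_assoc]; exact hb _ (ha u hu)
  have hUfin : Finite U := by
    have hfin : (Set.range fun j : ℕ => y ^ j).Finite := by
      refine ((Set.finite_lt_nat d).image fun j => y ^ j).subset ?_
      rintro _ ⟨j, rfl⟩
      exact ⟨j % d, Nat.mod_lt _ hd, (pow_eq_pow_mod j hy).symm⟩
    have : Module.Finite F U := Module.Finite.span_of_finite F hfin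
    exact Module.finite_of_finite F
  have hEfin : Finite (Algebra.adjoin K {x, y}) := by
    refine Finite.of_injective (β := U) (fun z => ⟨z, ?_⟩) ?_
    · simpa using hUadj z z.2 1 (by simpa using hpow 0)
    · intro a b h
      exact Subtype.ext (congrArg (fun u : U => (u : D)) h)
  have hcomm := (Finite.isDomain_to_isField (Algebra.adjoin K {x, y})).mul_comm
    ⟨x, Algebra.subset_adjoin (by simp)⟩ ⟨y, Algebra.subset_adjoin (by simp)⟩
  exact congrArg Subtype.val hcomm

/-- A domain whose nonzero elements are all roots of unity is commutative. -/
theorem mul_comm_of_forall_pow_eq_one (h : ∀ x : D, x ≠ 0 → ∃ d, 0 < d ∧ x ^ d = 1) (x z : D) :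
    x * z = z * x := by
  by_contra hxz
  have hx0 : x ≠ 0 := by rintro rfl; simp at hxz
  obtain ⟨p, hp⟩ := CharP.exists D
  have hp0 : p ≠ 0 := by
    rintro rfl
    have := CharP.charP_to_charZero D
    obtain ⟨d, hd, h2⟩ := h 2 two_ne_zero
    have : 2 ^ d = 1 := by exact_mod_cast h2
    exact absurd this (Nat.one_lt_two_pow hd.ne').ne'
  have : Fact p.Prime := ⟨(CharP.char_is_prime_or_zero D p).resolve_right hp0⟩
  let : Algebra (ZMod p) D := ZMod.algebra D p
  obtain ⟨d, hd, hx⟩ := h x hx0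
  have : Finite (Algebra.adjoin (ZMod p) {x}) := by
    have hint : IsIntegral (ZMod p) x := .of_pow hd (hx ▸ isIntegral_one)
    have := Module.Finite.iff_fg.mpr hint.fg_adjoin_singleton
    exact Module.finite_of_finite (ZMod p) (M := (Algebra.adjoin (ZMod p) {x}))
  obtain ⟨c, hcF, hc, y, hy, hxy⟩ := exists_mul_sub_mul_eq_of_finite_adjoin (p := p) hxz
  obtain ⟨e, he, hye⟩ := h y hy
  have := commute_of_mul_sub_mul_eq hcF hxy he hye
  rw [this, sub_self] at hxy
  exact mul_ne_zero hc hy hxy.symm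

end Domain

theorem IsReduced.commute_of_isIdempotentElem {R : Type*} [Ring R] [IsReduced R] {e : R}
    (he : e * e = e) (x : R) : e * x = x * e := by
  have h1 : e * x - e * x * e = 0 := by
    refine IsReduced.eq_zero _ ⟨2, ?_⟩
    simp only [pow_two, mul_sub, sub_mul, mul_assoc]
    simp only [he, ← mul_assoc e e, sub_self]
  have h2 : x * e - e * x * e = 0 := by
    refine IsReduced.eq_zero _ ⟨2, ?_⟩
    simp only [pow_two, mul_sub, sub_mul, mul_assoc]
    simp only [he, ← mul_assoc e e, sub_self]
  rw [sub_eq_zero.mp h1, sub_eq_zero.mp h2]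

/-- Jacobson's commutativity theorem for reduced rings in which every element is potent. -/
theorem mul_comm_of_forall_pow_succ_eq_self {R : Type*} [Ring R] [IsReduced R]
    (h : ∀ x : R, ∃ d, 0 < d ∧ x ^ (d + 1) = x) (x y : R) : x * y = y * x := by
  have hidem {a : R} {d : ℕ} (hd : 0 < d) (ha : a ^ (d + 1) = a) : a ^ d * a ^ d = a ^ d := by
    obtain ⟨k, rfl⟩ := Nat.exists_eq_succ_of_ne_zero hd.ne'
    rw [← pow_add, show k.succ + k.succ = (k.succ + 1) + k by omega, pow_add, ha, ← pow_succ']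
  have htwo (M : Ideal R) : M.IsTwoSided := by
    refine ⟨fun {a} b ha => ?_⟩
    obtain ⟨d, hd, hpow⟩ := h a
    have hcent := IsReduced.commute_of_isIdempotentElem (hidem hd hpow) b
    obtain ⟨k, rfl⟩ := Nat.exists_eq_succ_of_ne_zero hd.ne'
    have : a * b = a * b * a ^ k * a := by
      rw [mul_assoc, ← pow_succ, mul_assoc, ← hcent, ← mul_assoc, ← pow_succ', hpow]
    rw [this]
    exact M.mul_mem_left _ ha
  by_contra hxy
  set z := x * y - y * x with hz
  have hz0 : z ≠ 0 := sub_ne_zero.mpr hxy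
  obtain ⟨n, hn, hzn⟩ := h z
  have hspan : Ideal.span {1 - z ^ n} ≠ ⊤ := by
    rw [Ne, Ideal.eq_top_iff_one, Ideal.mem_span_singleton']
    rintro ⟨r, hr⟩
    apply hz0
    have : z ^ n = 0 := by
      have := congrArg (· * z ^ n) hr
      simpa [mul_assoc, sub_mul, hidem hn hzn] using this.symm
    rw [← hzn, pow_succ, this, zero_mul]
  obtain ⟨M, hM, hle⟩ := Ideal.exists_le_maximal _ hspan
  have hMe : 1 - z ^ n ∈ M := hle (Ideal.mem_span_singleton_self _)
  have := htwo M
  have hnt : Nontrivial (R ⧸ M) := Ideal.Quotient.nontrivial_iff.mpr hM.ne_top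
  have hpow_one (a : R ⧸ M) (ha : a ≠ 0) : ∃ d, 0 < d ∧ a ^ d = 1 := by
    obtain ⟨a, rfl⟩ := Ideal.Quotient.mk_surjective a
    rw [Ne, Ideal.Quotient.eq_zero_iff_mem] at ha
    obtain ⟨d, hd, had⟩ := h a
    refine ⟨d, hd, ?_⟩
    have he : a ^ d ∉ M := fun hmem => ha <| by
      rw [← had, pow_succ']
      exact M.mul_mem_left _ hmem
    obtain ⟨r, m, hm, hrm⟩ := hM.exists_inv he
    rw [eq_comm, ← map_pow, ← map_one (Ideal.Quotient.mk M), Ideal.Quotient.eq]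
    have : 1 - a ^ d = m * (1 - a ^ d) := by
      have := congrArg (· * (1 - a ^ d)) hrm
      simpa [add_mul, mul_assoc, mul_sub, hidem hd had] using this.symm
    rw [this]
    exact M.mul_mem_right _ hm
  have : NoZeroDivisors (R ⧸ M) := by
    refine ⟨fun {a b} hab => or_iff_not_imp_left.mpr fun ha => ?_⟩
    obtain ⟨d, hd, had⟩ := hpow_one a ha
    obtain ⟨k, rfl⟩ := Nat.exists_eq_succ_of_ne_zero hd.ne'
    rw [← one_mul b, ← had, pow_succ, mul_assoc, hab, mul_zero]
  have : IsDomain (R ⧸ M) := NoZeroDivisors.to_isDomain _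
  have hzM : z ∈ M := by
    rw [← Ideal.Quotient.eq_zero_iff_mem, hz, map_sub, map_mul, map_mul, sub_eq_zero]
    exact mul_comm_of_forall_pow_eq_one hpow_one _ _
  refine hM.ne_top (M.eq_top_iff_one.mpr ?_)
  rw [← sub_add_cancel 1 (z ^ n)]
  exact M.add_mem hMe (M.pow_mem_of_mem hzM n hn)

/-- Every finite subset lies in a finitely generated additive subgroup closed under products. -/
def IsLocallyFiniteOverInt (R : Type*) [Ring R] : Prop :=
  ∀ S : Finset R, ∃ U : Submodule ℤ R, U.FG ∧ 1 ∈ U ∧ (∀ x ∈ S, x ∈ U) ∧ U * U ≤ U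

theorem isLocallyFiniteOverInt_of_isReduced {R : Type*} [Ring R] [IsReduced R]
    (h : ∀ x : R, ∃ d, 0 < d ∧ x ^ (d + 1) = x) : IsLocallyFiniteOverInt R := by
  intro S
  let _ : CommRing R :=
    { (inferInstance : Ring R) with mul_comm := mul_comm_of_forall_pow_succ_eq_self h }
  refine ⟨Subalgebra.toSubmodule (Algebra.adjoin ℤ (S : Set R)),
    fg_adjoin_of_finite S.finite_toSet fun x _ => ?_, one_mem (Algebra.adjoin ℤ (S : Set R)),
    fun x hx => Algebra.subset_adjoin hx,
    Submodule.mul_le.mpr fun a ha b hb => mul_mem (S := Subalgebra ℤ R) ha hb⟩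
  obtain ⟨d, hd, hx⟩ := h x
  refine ⟨Polynomial.X ^ (d + 1) - Polynomial.X, Polynomial.monic_X_pow_sub
    (by simpa [Polynomial.degree_X] using by exact_mod_cast Nat.lt_add_of_pos_left hd), ?_⟩
  simp [hx]

section Extension

variable {A : Type*} [Ring A]

theorem exists_mul_self_le_of_mul_self_le_sup {W X : Submodule ℤ A} (hW : W.FG) (hX : X.FG)
    (hW1 : 1 ∈ W) (hWW : W * W ≤ W ⊔ X) {N : ℕ} (hN : (W * X * W) ^ N = 0) :
    ∃ U : Submodule ℤ A, U.FG ∧ W ≤ U ∧ U * U ≤ U := by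
  have hone : 1 ≤ W := Submodule.one_le.mpr hW1
  rw [← Submodule.add_eq_sup] at hWW
  set Y := W * X * W with hY
  have hYfg : Y.FG := (hW.mul hX).mul hW
  have hWX : W * X ≤ Y := le_mul_of_one_le_right' hone
  have hXW : X * W ≤ Y := by
    simpa [hY, mul_assoc] using mul_le_mul_left hone (X * W)
  have hXY : X ≤ Y := (le_mul_of_one_le_left' hone).trans hWX
  have hWY : W * Y ≤ Y + Y * Y := calc
    W * Y = W * W * (X * W) := by simp only [hY, mul_assoc]
    _ ≤ (W + X) * (X * W) := by gcongr
    _ = Y + X * (X * W) := by simp only [hY, mul_assoc, add_mul]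
    _ ≤ Y + Y * Y := by gcongr
  have hYW : Y * W ≤ Y + Y * Y := calc
    Y * W = W * X * (W * W) := by simp only [hY, mul_assoc]
    _ ≤ W * X * (W + X) := by gcongr
    _ = Y + W * X * X := by simp only [hY, mul_add]
    _ ≤ Y + Y * Y := by gcongr
  let G := ∑ i ∈ Finset.range N, Y ^ i
  have hG : 1 + Y * G = G := by
    have h1 : ∑ i ∈ Finset.range (N + 1), Y ^ i = G := by
      rw [Finset.sum_range_succ, hN, add_zero]
    conv_rhs => rw [← h1, Finset.sum_range_succ', pow_zero, add_comm]
    rw [Finset.mul_sum]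
    simp only [pow_succ']
  have hcomm : Commute Y G := Commute.sum_right _ _ _ fun i _ => (Commute.refl Y).pow_right i
  have h1G : 1 ≤ G := by
    rw [← hG, Submodule.add_eq_sup]; exact le_sup_left
  have hYG : Y * G ≤ G := by
    conv_rhs => rw [← hG]
    rw [Submodule.add_eq_sup]; exact le_sup_right
  have hYYG : Y * (Y * G) ≤ Y * G := by gcongr
  have hGfg : G.FG := by
    refine Finset.sum_induction _ Submodule.FG (fun _ _ => Submodule.FG.sup) Submodule.fg_bot
      fun i _ => hYfg.pow i
  have hYle : Y ≤ Y * G := le_mul_of_one_le_right' h1G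
  have hYiG (i : ℕ) : Y ^ i * G ≤ G := by
    induction i with
    | zero => simp
    | succ i ih => rw [pow_succ, mul_assoc]; exact (mul_le_mul_right hYG _).trans ih
  have hGG : G * G ≤ G := by
    change (∑ i ∈ Finset.range N, Y ^ i) * G ≤ G
    rw [Finset.sum_mul]
    exact Finset.sum_induction _ (· ≤ G) (fun _ _ => sup_le) bot_le fun i _ => hYiG i
  have hsum : (Y + Y * Y) * G ≤ Y * G := by
    rw [add_mul, mul_assoc Y Y G]
    exact sup_le le_rfl hYYG
  refine ⟨W ⊔ Y * G, hW.sup (hYfg.mul hGfg), le_sup_left, ?_⟩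
  rw [Submodule.mul_sup, Submodule.sup_mul, Submodule.sup_mul]
  refine sup_le (sup_le ?_ ?_) (sup_le ?_ ?_)
  · exact hWW.trans (sup_le_sup_left (hXY.trans hYle) W)
  · refine le_sup_of_le_right ?_
    calc Y * G * W = G * (Y * W) := by rw [hcomm.eq, mul_assoc]
      _ ≤ G * (Y + Y * Y) := by gcongr
      _ = (Y + Y * Y) * G := (hcomm.add_left (hcomm.mul_left hcomm)).eq.symm
      _ ≤ Y * G := hsum
  · refine le_sup_of_le_right ?_
    rw [← mul_assoc]
    exact (mul_le_mul_left hWY G).trans hsum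
  · refine le_sup_of_le_right ?_
    calc Y * G * (Y * G) = Y * (Y * (G * G)) := by
          rw [mul_assoc, ← mul_assoc G, ← hcomm.eq, mul_assoc Y G]
      _ ≤ Y * (Y * G) := by gcongr
      _ ≤ Y * G := hYYG

theorem Submodule.FG.exists_pow_eq_zero {Y : Submodule ℤ A} (hY : Y.FG)
    (hnil : ∀ S : Finset A, (∀ x ∈ S, x ∈ Y) →
      ∃ N : ℕ, 0 < N ∧ ∀ l : List A, (∀ x ∈ l, x ∈ S) → l.length = N → l.prod = 0) :
    ∃ N : ℕ, Y ^ N = 0 := by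
  obtain ⟨S, rfl⟩ := hY
  obtain ⟨N, -, hN⟩ := hnil S fun x hx => Submodule.subset_span hx
  refine ⟨N, ?_⟩
  rw [Submodule.span_pow, Submodule.zero_eq_bot, Submodule.span_eq_bot]
  intro x hx
  obtain ⟨f, rfl⟩ := Set.mem_pow.mp hx
  refine hN _ (fun y hy => ?_) (by simp)
  obtain ⟨i, rfl⟩ := (List.mem_ofFn' _ _).mp hy
  exact (f i).2

theorem isLocallyFiniteOverInt_of_surjective {R : Type*} [Ring R] (f : A →+* R)
    (hf : Function.Surjective f)
    (hnil : ∀ S : Finset A, (∀ x ∈ S, f x = 0) →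
      ∃ N : ℕ, 0 < N ∧ ∀ l : List A, (∀ x ∈ l, x ∈ S) → l.length = N → l.prod = 0)
    (hR : IsLocallyFiniteOverInt R) : IsLocallyFiniteOverInt A := by
  classical
  intro S
  let φ : A →ₐ[ℤ] R := f.toIntAlgHom
  obtain ⟨V, ⟨T, hT⟩, hV1, hSV, hVV⟩ := hR (S.image f)
  let W : Submodule ℤ A :=
    Submodule.span ℤ (insert 1 (S ∪ T.image (Function.surjInv hf)) : Finset A)
  have hWfg : W.FG := ⟨_, rfl⟩
  have hW1 : 1 ∈ W := Submodule.subset_span (by simp)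
  have hSW (x : A) (hx : x ∈ S) : x ∈ W := Submodule.subset_span (by simp [hx])
  have hWV : W.map φ.toLinearMap = V := by
    apply le_antisymm
    · rw [Submodule.map_span_le]
      intro x hx
      simp only [Finset.coe_insert, Finset.coe_union, Finset.coe_image, Set.mem_insert_iff,
        Set.mem_union, Set.mem_image, Finset.mem_coe] at hx
      rcases hx with rfl | hx | ⟨t, ht, rfl⟩
      · simpa using hV1
      · exact hSV _ (Finset.mem_image_of_mem f hx)
      · change f _ ∈ V
        rw [Function.surjInv_eq hf, ← hT]
        exact Submodule.subset_span ht
    · rw [← hT, Submodule.span_le]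
      intro t ht
      exact ⟨Function.surjInv hf t,
        Submodule.subset_span (by simpa using Or.inr (Or.inr ⟨t, ht, rfl⟩)),
        Function.surjInv_eq hf t⟩
  obtain ⟨P, hP⟩ := hWfg.mul hWfg
  have hlift : ∀ g ∈ P, ∃ w ∈ W, f w = f g := by
    intro g hg
    have hgW : g ∈ W * W := hP ▸ Submodule.subset_span hg
    have : φ g ∈ W.map φ.toLinearMap := by
      rw [hWV]
      refine hVV ?_
      rw [← hWV, ← Submodule.map_mul]
      exact ⟨g, hgW, rfl⟩
    exact this
  choose! w hw hfw using hlift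
  let X : Submodule ℤ A := Submodule.span ℤ (P.image fun g => g - w g : Finset A)
  have hXfg : X.FG := ⟨_, rfl⟩
  have hWW : W * W ≤ W ⊔ X := by
    rw [← hP, Submodule.span_le]
    intro g hg
    rw [← add_sub_cancel (w g) g]
    exact Submodule.add_mem_sup (hw g hg)
      (Submodule.subset_span (Finset.mem_coe.mpr (Finset.mem_image_of_mem _ hg)))
  have hX0 : X.map φ.toLinearMap = ⊥ := by
    rw [eq_bot_iff, Submodule.map_span_le]
    intro x hx
    obtain ⟨g, hg, rfl⟩ := Finset.mem_image.mp (Finset.mem_coe.mp hx)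
    change f _ = 0
    rw [map_sub, hfw g hg, sub_self]
  obtain ⟨N, hN⟩ := Submodule.FG.exists_pow_eq_zero ((hWfg.mul hXfg).mul hWfg) fun S' hS' =>
    hnil S' fun x hx => by
      have : φ x ∈ (W * X * W).map φ.toLinearMap := ⟨x, hS' x hx, rfl⟩
      rw [Submodule.map_mul, Submodule.map_mul, hX0, Submodule.mul_bot, Submodule.bot_mul] at this
      exact this
  obtain ⟨U, hU, hWU, hUU⟩ := exists_mul_self_le_of_mul_self_le_sup hWfg hXfg hW1 hWW hN
  exact ⟨U, hU, hWU hW1, fun x hx => hWU (hSW x hx), hUU⟩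

end Extension

theorem IsPeriodicRing.isLocallyFiniteOverInt {A : Type*} [Ring A] (hper : IsPeriodicRing A)
    (h2 : IsWeakly2Primal A) : IsLocallyFiniteOverInt A := by
  obtain ⟨⟨I, hI⟩, hnil⟩ := h2
  let f : A →+* I.ringCon.Quotient := I.ringCon.mk'
  have hf : Function.Surjective f := I.ringCon.mk'_surjective
  have hker (x : A) : f x = 0 ↔ IsNilpotent x := by
    rw [← hI, ← TwoSidedIdeal.mem_ker, TwoSidedIdeal.ker_ringCon_mk']
  have : IsReduced I.ringCon.Quotient := by
    refine ⟨fun x ⟨n, hx⟩ => ?_⟩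
    obtain ⟨a, rfl⟩ := hf x
    rw [← map_pow, hker] at hx
    obtain ⟨k, hk⟩ := hx
    exact (hker a).mpr ⟨n * k, by rw [pow_mul, hk]⟩
  refine isLocallyFiniteOverInt_of_surjective f hf (fun S hS => hnil S fun x hx =>
    (hker x).mp (hS x hx)) (isLocallyFiniteOverInt_of_isReduced fun x => ?_)
  obtain ⟨a, rfl⟩ := hf x
  obtain ⟨m, n, -, hnm, h⟩ := hper a
  refine ⟨m - n, Nat.sub_pos_of_lt hnm, IsReduced.pow_succ_eq_self (n := n) ?_⟩
  rw [Nat.add_sub_cancel' hnm.le, ← map_pow, h, map_pow]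

theorem IsPeriodicRing.exists_intCast_eq_zero {A : Type*} [Ring A] (hper : IsPeriodicRing A) :
    ∃ c : ℤ, c ≠ 0 ∧ (c : A) = 0 := by
  obtain ⟨m, n, -, hnm, h⟩ := hper 2
  refine ⟨2 ^ m - 2 ^ n, sub_ne_zero.mpr ?_, by push_cast; rw [h, sub_self]⟩
  exact_mod_cast (Nat.pow_lt_pow_right one_lt_two hnm).ne'

theorem finite_of_fg_of_zsmul_eq_zero {M : Type*} [AddCommGroup M] {c : ℤ} (hc : c ≠ 0)
    (h : ∀ x : M, c • x = 0) {U : Submodule ℤ M} (hU : U.FG) : Finite U := by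
  have := Module.Finite.iff_fg.mpr hU
  apply Module.finite_of_fg_torsion
  intro x
  exact ⟨⟨c, mem_nonZeroDivisors_of_ne_zero hc⟩, by ext; simpa using h x⟩

theorem exists_pow_eq_pow_of_mem_finite {R : Type*} [Ring R] {U : Submodule ℤ R} [Finite U]
    (hUU : U * U ≤ U) {x : R} (hx : x ∈ U) : ∃ m n : ℕ, 0 < n ∧ n < m ∧ x ^ m = x ^ n := by
  have hpow (j : ℕ) : x ^ (j + 1) ∈ U := by
    induction j with
    | zero => simpa using hx
    | succ j ih => rw [pow_succ]; exact hUU (Submodule.mul_mem_mul ih hx)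
  obtain ⟨i, j, hij, h⟩ := Finite.exists_ne_map_eq_of_infinite fun j : ℕ => (⟨_, hpow j⟩ : U)
  replace h : x ^ (i + 1) = x ^ (j + 1) := congrArg (fun u : U => (u : R)) h
  rcases hij.lt_or_gt with hlt | hlt
  · exact ⟨j + 1, i + 1, i.succ_pos, by omega, h.symm⟩
  · exact ⟨i + 1, j + 1, j.succ_pos, by omega, h⟩

/-- If `A` and `B` are `k`-algebras which, as rings, are weakly 2-primal and
periodic, then the tensor product `A ⊗[k] B` is a periodic ring. -/
theorem periodic_tensorProduct_of_weakly2Primal (k : Type*) [CommRing k]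
    (A B : Type*) [Ring A] [Ring B] [Algebra k A] [Algebra k B]
    (hA2 : IsWeakly2Primal A) (hAper : IsPeriodicRing A)
    (hB2 : IsWeakly2Primal B) (hBper : IsPeriodicRing B) :
    IsPeriodicRing (A ⊗[k] B) := by
  classical
  intro x
  obtain ⟨S, hS⟩ := TensorProduct.exists_finset x
  obtain ⟨U, hU, -, hSU, hUU⟩ := hAper.isLocallyFiniteOverInt hA2 (S.image Prod.fst)
  obtain ⟨V, hV, -, hSV, hVV⟩ := hBper.isLocallyFiniteOverInt hB2 (S.image Prod.snd)
  let φ : A →ₐ[ℤ] A ⊗[k] B :=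
    (Algebra.TensorProduct.includeLeft : A →ₐ[k] A ⊗[k] B).toRingHom.toIntAlgHom
  let ψ : B →ₐ[ℤ] A ⊗[k] B :=
    (Algebra.TensorProduct.includeRight : B →ₐ[k] A ⊗[k] B).toRingHom.toIntAlgHom
  have hφψ (a : A) (b : B) : φ a * ψ b = a ⊗ₜ[k] b := by
    change (a ⊗ₜ[k] (1 : B)) * ((1 : A) ⊗ₜ[k] b) = _
    simp
  have hψφ (a : A) (b : B) : ψ b * φ a = a ⊗ₜ[k] b := by
    change ((1 : A) ⊗ₜ[k] b) * (a ⊗ₜ[k] (1 : B)) = _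
    simp
  set U' := U.map φ.toLinearMap with hU'
  set V' := V.map ψ.toLinearMap with hV'
  have hcomm : V' * U' = U' * V' := by
    refine Submodule.mul_comm_of_commute ?_
    rintro _ ⟨b, -, rfl⟩ _ ⟨a, -, rfl⟩
    exact (hψφ a b).trans (hφψ a b).symm
  have hmul : U' * V' * (U' * V') ≤ U' * V' := calc
    U' * V' * (U' * V') = U' * U' * (V' * V') := by
      rw [mul_assoc, ← mul_assoc V', hcomm]; simp only [mul_assoc]
    _ ≤ U' * V' := by
      rw [hU', hV', ← Submodule.map_mul, ← Submodule.map_mul]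
      exact mul_le_mul' (Submodule.map_mono hUU) (Submodule.map_mono hVV)
  have hx : x ∈ U' * V' := by
    rw [hS]
    refine Submodule.sum_mem _ fun i hi => ?_
    rw [← hφψ]
    exact Submodule.mul_mem_mul ⟨_, hSU _ (Finset.mem_image_of_mem _ hi), rfl⟩
      ⟨_, hSV _ (Finset.mem_image_of_mem _ hi), rfl⟩
  obtain ⟨c, hc, hcA⟩ := hAper.exists_intCast_eq_zero
  have : Finite ↥(U' * V') := by
    refine finite_of_fg_of_zsmul_eq_zero hc (fun y => ?_) ((hU.map _).mul (hV.map _))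
    rw [zsmul_eq_mul, ← map_intCast φ, hcA, map_zero, zero_mul]
  exact exists_pow_eq_pow_of_mem_finite hmul hx
end
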